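/- Let F = F_Y^Δ ∈ Σ, let Ω ⊆ A_F be non-empty, let a, b ∈ Φ^red be non-proportional roots, and let m, n ≥ 1 be integers with ma + nb ∈ Φ. Then: (i) if f_Ω(a) = −∞ and f_Ω(b) ∈ ℝ ∪ {−∞} (or symmetrically f_Ω(b) = −∞ and f_Ω(a) ∈ ℝ ∪ {−∞}), then f_Ω(ma + nb) = −∞; (ii) if f_Ω(a) ∈ ℝ and f_Ω(b) ∈ ℝ, then f_Ω(ma + nb) ≤ m·f_Ω(a) + n·f_Ω(b). -/

import Mathlib

/-!
Common setup for Werner, "Compactifications of Bruhat-Tits buildings associated to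
linear representations":  a finite-dimensional real vector space `A` (the apartment),
a root system `Φ` in the dual space together with a Weyl-group invariant inner
product, a finite Weyl-invariant set `Λ` of (K-)weights, and for every basis `Δ`
of `Φ` a highest weight `lam0 Δ ∈ Λ`.
-/

open Pointwise Filter Topology Bornology
open scoped Classical

noncomputable section

/-- A set `M` of linear forms is *connected* if the graph with vertex set `M` and an
edge between `m` and `n` iff `inn m n ≠ 0` is connected. -/
def GraphConnected {D : Type*} (inn : D → D → ℝ) (M : Set D) : Prop :=
  ∀ m ∈ M, ∀ n ∈ M,
    Relation.ReflTransGen (fun x y => x ∈ M ∧ y ∈ M ∧ inn x y ≠ 0) m n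

/-- The coefficients of `μ` as a linear combination of the elements of `Δ` (chosen
arbitrarily if one exists; it is unique when `Δ` is linearly independent). -/
noncomputable def coeffs {A : Type*} [AddCommGroup A] [Module ℝ A]
    (Δ : Finset (Module.Dual ℝ A)) (μ : Module.Dual ℝ A) : Module.Dual ℝ A → ℝ :=
  if h : ∃ n : Module.Dual ℝ A → ℝ, μ = ∑ b ∈ Δ, n b • b then h.choose else fun _ => 0

/-- The support `[μ]` of `μ` with respect to the basis `Δ`: the set of elements of `Δ`
whose coefficient in `μ` is nonzero. -/
noncomputable def supp {A : Type*} [AddCommGroup A] [Module ℝ A]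
    (Δ : Finset (Module.Dual ℝ A)) (μ : Module.Dual ℝ A) : Finset (Module.Dual ℝ A) :=
  Δ.filter fun a => coeffs Δ μ a ≠ 0

/-- Raw data: a finite set `Φ` of roots in the dual of `A`, a product `inn` on the dual,
a finite set `Λ` of weights, and a highest weight `lam0 Δ` for every basis `Δ`. -/
structure RootWeightData (A : Type*) [NormedAddCommGroup A] [NormedSpace ℝ A]
    [FiniteDimensional ℝ A] where
  Φ : Finset (Module.Dual ℝ A)
  inn : Module.Dual ℝ A → Module.Dual ℝ A → ℝ
  Λ : Finset (Module.Dual ℝ A)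
  lam0 : Finset (Module.Dual ℝ A) → Module.Dual ℝ A

namespace RootWeightData

variable {A : Type*} [NormedAddCommGroup A] [NormedSpace ℝ A] [FiniteDimensional ℝ A]
variable (S : RootWeightData A)

/-- The reflection associated to the root `a`. -/
def refl (a : Module.Dual ℝ A) : Function.End (Module.Dual ℝ A) :=
  fun x => x - (2 * S.inn x a / S.inn a a) • a

/-- The Weyl group `W`, generated by the reflections in the roots. -/
def weyl : Submonoid (Function.End (Module.Dual ℝ A)) :=
  Submonoid.closure {f | ∃ a ∈ S.Φ, f = S.refl a}

/-- `Δ` is a basis of the root system `Φ`: a linearly independent subset of `Φ` such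
that every root is a nonnegative or nonpositive linear combination of `Δ`. -/
def IsBase (Δ : Finset (Module.Dual ℝ A)) : Prop :=
  (↑Δ : Set (Module.Dual ℝ A)) ⊆ (S.Φ : Set (Module.Dual ℝ A)) ∧
  LinearIndependent ℝ (fun a : (Δ : Set (Module.Dual ℝ A)) => (a : Module.Dual ℝ A)) ∧
  ∀ a ∈ S.Φ,
    (∃ n : Module.Dual ℝ A → ℝ, (∀ b ∈ Δ, 0 ≤ n b) ∧ a = ∑ b ∈ Δ, n b • b) ∨
    (∃ n : Module.Dual ℝ A → ℝ, (∀ b ∈ Δ, 0 ≤ n b) ∧ a = -∑ b ∈ Δ, n b • b)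

/-- `Y` is an admissible subset of the basis `Δ`: `Y ⊆ Δ` and `Y ∪ {λ₀(Δ)}` is
connected. -/
def Admissible (Δ Y : Finset (Module.Dual ℝ A)) : Prop :=
  Y ⊆ Δ ∧ GraphConnected S.inn ((↑Y : Set (Module.Dual ℝ A)) ∪ {S.lam0 Δ})

end RootWeightData

/-- The whole setting of Werner's paper: the data of `RootWeightData`, where `Φ` is a
(crystallographic, possibly non-reduced) root system spanning the dual of `A`, `inn` is
a Weyl-invariant inner product, `Λ` is a finite Weyl-invariant set of weights, and
`lam0` picks, Weyl-equivariantly, a highest weight for each basis, dominating all of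
`Λ`; moreover a subset of a basis is admissible iff it is the support of
`λ₀(Δ) - λ` for some weight `λ`. -/
structure RootWeightSystem (A : Type*) [NormedAddCommGroup A] [NormedSpace ℝ A]
    [FiniteDimensional ℝ A] extends RootWeightData A where
  inn_symm : ∀ x y, inn x y = inn y x
  inn_add_left : ∀ x y z, inn (x + y) z = inn x z + inn y z
  inn_smul_left : ∀ (c : ℝ) (x y), inn (c • x) y = c * inn x y
  inn_pos : ∀ x, x ≠ 0 → 0 < inn x x
  root_ne_zero : ∀ a ∈ Φ, a ≠ (0 : Module.Dual ℝ A)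
  neg_mem : ∀ a ∈ Φ, -a ∈ Φ
  refl_mem : ∀ a ∈ Φ, ∀ b ∈ Φ, toRootWeightData.refl a b ∈ Φ
  inn_weyl_invariant :
    ∀ w ∈ toRootWeightData.weyl, ∀ x y, inn (w x) (w y) = inn x y
  phi_spans : Submodule.span ℝ (Φ : Set (Module.Dual ℝ A)) = ⊤
  exists_base : ∃ Δ, toRootWeightData.IsBase Δ
  base_cover : ∀ x : A, ∃ Δ, toRootWeightData.IsBase Δ ∧ ∀ a ∈ Δ, 0 ≤ a x
  base_weyl : ∀ w ∈ toRootWeightData.weyl, ∀ Δ, toRootWeightData.IsBase Δ →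
    toRootWeightData.IsBase (Δ.image (w : Module.Dual ℝ A → Module.Dual ℝ A))
  lam0_mem : ∀ Δ, toRootWeightData.IsBase Δ → lam0 Δ ∈ Λ
  lam0_dominates : ∀ Δ, toRootWeightData.IsBase Δ → ∀ l ∈ Λ,
    ∃ n : Module.Dual ℝ A → ℝ, (∀ a ∈ Δ, 0 ≤ n a) ∧ lam0 Δ - l = ∑ a ∈ Δ, n a • a
  weight_weyl_invariant : ∀ w ∈ toRootWeightData.weyl, ∀ l ∈ Λ, w l ∈ Λ
  lam0_equivariant : ∀ w ∈ toRootWeightData.weyl, ∀ Δ, toRootWeightData.IsBase Δ →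
    lam0 (Δ.image (w : Module.Dual ℝ A → Module.Dual ℝ A)) = w (lam0 Δ)
  integrality : ∀ l ∈ Λ, ∀ a ∈ Φ, ∃ k : ℤ, 2 * inn l a / inn a a = (k : ℝ)
  admissible_iff_support : ∀ Δ, toRootWeightData.IsBase Δ → ∀ Y ⊆ Δ,
    (toRootWeightData.Admissible Δ Y ↔ ∃ l ∈ Λ, supp Δ (lam0 Δ - l) = Y)

namespace RootWeightSystem

variable {A : Type*} [NormedAddCommGroup A] [NormedSpace ℝ A] [FiniteDimensional ℝ A]
variable (S : RootWeightSystem A)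

/-- The face `F_Y^Δ` of the apartment `A` associated to a basis `Δ` and an admissible
subset `Y ⊆ Δ`. -/
def Face (Δ Y : Finset (Module.Dual ℝ A)) : Set A :=
  {x | (∀ a ∈ Y, a x = 0) ∧
    ∀ l ∈ S.Λ, ¬ supp Δ (S.lam0 Δ - l) ⊆ Y → 0 < (S.lam0 Δ - l) x}

/-- `F` belongs to the collection `Σ` of faces. -/
def IsFace (F : Set A) : Prop :=
  ∃ Δ Y, S.toRootWeightData.IsBase Δ ∧ S.toRootWeightData.Admissible Δ Y ∧
    F = S.Face Δ Y

/-- The collection `Σ` of all faces. -/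
def Faces : Type _ := {F : Set A // S.IsFace F}

/-- The relation identifying `(F, u)` and `(F, v)` when `u - v ∈ ⟨F⟩`; the quotient is
the disjoint union `Ā = ⊔_{F ∈ Σ} A/⟨F⟩`. -/
def AbarRel (p q : S.Faces × A) : Prop :=
  p.1 = q.1 ∧ p.2 - q.2 ∈ Submodule.span ℝ p.1.val

/-- The compactified apartment `Ā = ⊔_{F ∈ Σ} A_F`, `A_F = A/⟨F⟩`. -/
def Abar : Type _ := Quot S.AbarRel

/-- `r_F(u)`, the image of `u ∈ A` in the stratum `A_F` of `Ā`. -/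
def mkAbar (F : S.Faces) (u : A) : S.Abar := Quot.mk _ (F, u)

/-- The basic set `Γ_F(U) = ⋃_{F' ⊆ cl F} r_{F'}(U + F)` of `Ā`. -/
def Gamma (F : S.Faces) (U : Set A) : Set S.Abar :=
  {p | ∃ F' : S.Faces, F'.val ⊆ closure F.val ∧ ∃ u ∈ U + F.val, p = S.mkAbar F' u}

/-- The topology of `Ā`, generated by the sets `Γ_F(U)` for `F ∈ Σ` and `U ⊆ A`
bounded and open. -/
instance : TopologicalSpace S.Abar :=
  TopologicalSpace.generateFrom
    {V : Set S.Abar | ∃ (F : S.Faces) (U : Set A),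
      IsOpen U ∧ IsBounded U ∧ V = S.Gamma F U}

/-- `f_Ω(a) = inf {t : Ω ⊆ cl_Ā {z ∈ A : a(z) ≥ -t}} ∈ ℝ ∪ {±∞}`, where `A` is embedded
in `Ā` as the stratum of the face `F₀ = {0}`. -/
def fOmega (F₀ : S.Faces) (Ω : Set S.Abar) (a : Module.Dual ℝ A) : EReal :=
  sInf ((fun t : ℝ => (t : EReal)) ''
    {t : ℝ | Ω ⊆ closure (S.mkAbar F₀ '' {z : A | -t ≤ a z})})

end RootWeightSystem


variable {A : Type*} [NormedAddCommGroup A] [NormedSpace ℝ A] [FiniteDimensional ℝ A]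

namespace RootWeightSystem

section Helpers

variable {A : Type*} [NormedAddCommGroup A] [NormedSpace ℝ A] [FiniteDimensional ℝ A]
variable (S : RootWeightSystem A)

theorem base_indep {Δ : Finset (Module.Dual ℝ A)} (hΔ : S.toRootWeightData.IsBase Δ)
    (f : Module.Dual ℝ A → ℝ) (h : ∑ b ∈ Δ, f b • b = 0) : ∀ b ∈ Δ, f b = 0 := by
  have h2 : LinearIndepOn ℝ (id : Module.Dual ℝ A → Module.Dual ℝ A)
      (Δ : Set (Module.Dual ℝ A)) := hΔ.2.1
  exact linearIndepOn_finset_iff.1 h2 f h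

theorem coeffs_spec {Δ : Finset (Module.Dual ℝ A)} (μ : Module.Dual ℝ A)
    (h : ∃ n : Module.Dual ℝ A → ℝ, μ = ∑ b ∈ Δ, n b • b) :
    μ = ∑ b ∈ Δ, coeffs Δ μ b • b := by
  have : coeffs Δ μ = h.choose := by unfold coeffs; rw [dif_pos h]
  rw [this]; exact h.choose_spec

theorem coeffs_eq {Δ : Finset (Module.Dual ℝ A)} (hΔ : S.toRootWeightData.IsBase Δ)
    (μ : Module.Dual ℝ A) (n : Module.Dual ℝ A → ℝ) (h : μ = ∑ b ∈ Δ, n b • b) :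
    ∀ b ∈ Δ, coeffs Δ μ b = n b := by
  have h1 := coeffs_spec μ ⟨n, h⟩
  intro b hb
  have := S.base_indep hΔ (fun b => coeffs Δ μ b - n b) (by
    have e : ∀ b : Module.Dual ℝ A,
        (coeffs Δ μ b - n b) • b = coeffs Δ μ b • b - n b • b := fun b => by module
    rw [Finset.sum_congr rfl fun b _ => e b, Finset.sum_sub_distrib, ← h1, ← h, sub_self]) b hb
  linarith

theorem supp_iff {Δ Y : Finset (Module.Dual ℝ A)} (hΔ : S.toRootWeightData.IsBase Δ)
    (hY : Y ⊆ Δ) (l : Module.Dual ℝ A) (hl : l ∈ S.Λ) :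
    supp Δ (S.lam0 Δ - l) ⊆ Y ↔
      S.lam0 Δ - l ∈ Submodule.span ℝ (Y : Set (Module.Dual ℝ A)) := by
  obtain ⟨n, hn, e⟩ := S.lam0_dominates Δ hΔ l hl
  have hc := S.coeffs_eq hΔ _ n e
  constructor
  · intro h
    rw [e]
    refine Submodule.sum_mem _ fun b hb => ?_
    by_cases hbY : b ∈ Y
    · exact Submodule.smul_mem _ _ (Submodule.subset_span hbY)
    · have : n b = 0 := by
        by_contra h0
        apply hbY
        apply h
        rw [supp, Finset.mem_filter]
        exact ⟨hb, by rw [hc b hb]; exact h0⟩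
      rw [this, zero_smul]
      exact Submodule.zero_mem _
  · intro h
    obtain ⟨f, hf, hs⟩ := Submodule.mem_span_finset.1 h
    have hs2 : S.lam0 Δ - l = ∑ b ∈ Δ, f b • b := by
      rw [← hs]
      refine Finset.sum_subset hY fun b _ hb => ?_
      have : f b = 0 := by
        by_contra h0
        exact hb (hf h0)
      rw [this, zero_smul]
    intro b hb
    rw [supp, Finset.mem_filter] at hb
    rw [S.coeffs_eq hΔ _ f hs2 b hb.1] at hb
    exact hf hb.2

theorem refl_weyl {a : Module.Dual ℝ A} (ha : a ∈ S.Φ) :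
    S.toRootWeightData.refl a ∈ S.toRootWeightData.weyl :=
  Submonoid.subset_closure ⟨a, ha, rfl⟩

theorem refl_weight {a l : Module.Dual ℝ A} (ha : a ∈ S.Φ) (hl : l ∈ S.Λ) :
    S.toRootWeightData.refl a l ∈ S.Λ :=
  S.weight_weyl_invariant _ (S.refl_weyl ha) l hl

/-- `Y` lies in the span of the differences of weights of the face. -/
theorem mem_span_diff {Δ Y : Finset (Module.Dual ℝ A)} (hΔ : S.toRootWeightData.IsBase Δ)
    (hY : S.toRootWeightData.Admissible Δ Y) (α : Module.Dual ℝ A) (hα : α ∈ Y) :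
    α ∈ Submodule.span ℝ {d : Module.Dual ℝ A |
      ∃ l ∈ S.Λ, supp Δ (S.lam0 Δ - l) ⊆ Y ∧ d = S.lam0 Δ - l} := by
  set V := Submodule.span ℝ {d : Module.Dual ℝ A |
      ∃ l ∈ S.Λ, supp Δ (S.lam0 Δ - l) ⊆ Y ∧ d = S.lam0 Δ - l} with hV
  have hgen : ∀ l ∈ S.Λ, supp Δ (S.lam0 Δ - l) ⊆ Y → S.lam0 Δ - l ∈ V :=
    fun l hl h => Submodule.subset_span ⟨l, hl, h, rfl⟩
  have hl0 : supp Δ (S.lam0 Δ - S.lam0 Δ) ⊆ Y := by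
    rw [S.supp_iff hΔ hY.1 _ (S.lam0_mem Δ hΔ), sub_self]
    exact Submodule.zero_mem _
  have key : ∀ β ∈ Y, ∀ l ∈ S.Λ, supp Δ (S.lam0 Δ - l) ⊆ Y → S.inn l β • β ∈ V := by
    intro β hβ l hl h
    have hβΦ : β ∈ S.Φ := hΔ.1 (hY.1 hβ)
    have hl' := S.refl_weight hβΦ hl
    have hpos := S.inn_pos β (S.root_ne_zero β hβΦ)
    have e : S.lam0 Δ - S.toRootWeightData.refl β l
        = (S.lam0 Δ - l) + (2 * S.inn l β / S.inn β β) • β := by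
      simp only [RootWeightData.refl]; abel
    have h1 : S.lam0 Δ - S.toRootWeightData.refl β l ∈ V := by
      apply hgen _ hl'
      rw [S.supp_iff hΔ hY.1 _ hl', e]
      refine Submodule.add_mem _ ((S.supp_iff hΔ hY.1 _ hl).1 h) ?_
      exact Submodule.smul_mem _ _ (Submodule.subset_span hβ)
    rw [e] at h1
    have h2 := (Submodule.add_mem_iff_right V (hgen l hl h)).1 h1
    have h3 := V.smul_mem (S.inn β β / 2) h2
    rw [smul_smul] at h3
    have : S.inn β β / 2 * (2 * S.inn l β / S.inn β β) = S.inn l β := by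
      field_simp
    rwa [this] at h3
  have key2 : ∀ β ∈ Y, ∀ v ∈ V, S.inn v β • β ∈ V := by
    intro β hβ v hv
    have inn0 : S.inn 0 β = 0 := by
      have := S.inn_smul_left 0 0 β
      simpa using this
    induction hv using Submodule.span_induction with
    | mem x hx =>
      obtain ⟨l, hl, h, rfl⟩ := hx
      have e : S.inn (S.lam0 Δ - l) β = S.inn (S.lam0 Δ) β - S.inn l β := by
        have := S.inn_add_left (S.lam0 Δ - l) l β
        rw [sub_add_cancel] at this
        linarith
      have e2 : (S.inn (S.lam0 Δ) β - S.inn l β) • β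
          = S.inn (S.lam0 Δ) β • β - S.inn l β • β := by module
      rw [e, e2]
      exact V.sub_mem (key β hβ _ (S.lam0_mem Δ hΔ) hl0) (key β hβ l hl h)
    | zero => rw [inn0, zero_smul]; exact V.zero_mem
    | add x y _ _ hx hy => rw [S.inn_add_left, add_smul]; exact V.add_mem hx hy
    | smul c x _ hx => rw [S.inn_smul_left, mul_smul]; exact V.smul_mem _ hx
  have hpath := hY.2 (S.lam0 Δ) (Or.inr rfl) α (Or.inl hα)
  have : ∀ w, Relation.ReflTransGen (fun x y => x ∈ (↑Y : Set (Module.Dual ℝ A)) ∪ {S.lam0 Δ} ∧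
      y ∈ (↑Y : Set (Module.Dual ℝ A)) ∪ {S.lam0 Δ} ∧ S.inn x y ≠ 0) (S.lam0 Δ) w →
      (w = S.lam0 Δ ∨ w ∈ V) ∧ (w ∈ Y → w ≠ S.lam0 Δ → w ∈ V) := by
    intro w hw
    have h1 : w = S.lam0 Δ ∨ w ∈ V := by
      induction hw with
      | refl => exact Or.inl rfl
      | tail _ hs ih =>
        rename_i v w _
        rcases hs.2.1 with hwY | hw0
        · right
          have : S.inn v w • w ∈ V := by
            rcases ih with rfl | hv
            · exact key w hwY _ (S.lam0_mem Δ hΔ) hl0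
            · exact key2 w hwY v hv
          exact (V.smul_mem_iff hs.2.2).1 this
        · exact Or.inl hw0
    exact ⟨h1, fun _ h => h1.resolve_left h⟩
  by_cases h0 : α = S.lam0 Δ
  · have hk := key α hα _ (S.lam0_mem Δ hΔ) hl0
    rw [← h0] at hk
    exact (V.smul_mem_iff (S.inn_pos α (S.root_ne_zero α (hΔ.1 (hY.1 hα)))).ne').1 hk
  · exact (this α hpath).2 hα h0

theorem face_iff {Δ Y : Finset (Module.Dual ℝ A)} (hΔ : S.toRootWeightData.IsBase Δ)
    (hY : S.toRootWeightData.Admissible Δ Y) (y : A) :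
    y ∈ S.Face Δ Y ↔ ∀ l ∈ S.Λ, (supp Δ (S.lam0 Δ - l) ⊆ Y → l y = S.lam0 Δ y) ∧
      (¬ supp Δ (S.lam0 Δ - l) ⊆ Y → l y < S.lam0 Δ y) := by
  constructor
  · rintro ⟨h1, h2⟩ l hl
    refine ⟨fun h => ?_, fun h => ?_⟩
    · have hm := (S.supp_iff hΔ hY.1 _ hl).1 h
      have : (S.lam0 Δ - l) y = 0 := by
        generalize S.lam0 Δ - l = d at hm
        induction hm using Submodule.span_induction with
        | mem x hx => exact h1 x hx
        | zero => rfl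
        | add x z _ _ hx hz => simp [hx, hz]
        | smul c x _ hx => simp [hx]
      rw [LinearMap.sub_apply] at this
      linarith
    · have := h2 l hl h
      rw [LinearMap.sub_apply] at this
      linarith
  · intro h
    refine ⟨fun α hα => ?_, fun l hl hn => ?_⟩
    · have hm := S.mem_span_diff hΔ hY α hα
      clear hα
      induction hm using Submodule.span_induction with
      | mem x hx =>
        obtain ⟨l, hl, hs, rfl⟩ := hx
        rw [LinearMap.sub_apply, (h l hl).1 hs, sub_self]
      | zero => rfl
      | add x z _ _ hx hz => simp [hx, hz]
      | smul c x _ hx => simp [hx]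
    · have := (h l hl).2 hn
      rw [LinearMap.sub_apply]
      linarith

theorem face_nonempty {Δ Y : Finset (Module.Dual ℝ A)} (hΔ : S.toRootWeightData.IsBase Δ)
    (hY : Y ⊆ Δ) :
    (S.Face Δ Y).Nonempty := by
  have hli : LinearIndepOn ℝ (id : Module.Dual ℝ A → Module.Dual ℝ A)
      (Δ : Set (Module.Dual ℝ A)) := hΔ.2.1
  let B := Module.Basis.extend hli
  let ψ : Module.Dual ℝ (Module.Dual ℝ A) :=
    B.constr ℝ (fun i => if (i : Module.Dual ℝ A) ∈ Y then (0 : ℝ) else 1)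
  obtain ⟨x, hx⟩ := (Module.evalEquiv ℝ A).surjective ψ
  have hval : ∀ b ∈ Δ, b x = if b ∈ Y then (0 : ℝ) else 1 := by
    intro b hb
    have h1 : b x = ψ b := by rw [← hx]; rfl
    rw [h1]
    have h2 := B.constr_basis ℝ (fun i => if (i : Module.Dual ℝ A) ∈ Y then (0 : ℝ) else 1)
      ⟨b, Module.Basis.subset_extend hli hb⟩
    rw [Module.Basis.extend_apply_self] at h2
    exact h2
  refine ⟨x, fun a ha => ?_, fun l hl h => ?_⟩
  · rw [hval a (hY ha), if_pos ha]
  · obtain ⟨n, hn, e⟩ := S.lam0_dominates Δ hΔ l hl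
    have hc := S.coeffs_eq hΔ _ n e
    obtain ⟨b, hb, hbY⟩ := Finset.not_subset.1 h
    rw [supp, Finset.mem_filter] at hb
    rw [hc b hb.1] at hb
    rw [e, LinearMap.sum_apply]
    refine Finset.sum_pos' (fun i hi => ?_) ⟨b, hb.1, ?_⟩
    · rw [LinearMap.smul_apply, smul_eq_mul, hval i hi]
      refine mul_nonneg (hn i hi) ?_
      split_ifs <;> norm_num
    · rw [LinearMap.smul_apply, smul_eq_mul, hval b hb.1, if_neg hbY, mul_one]
      exact lt_of_le_of_ne (hn b hb.1) (Ne.symm hb.2)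

theorem face_smul {Δ Y : Finset (Module.Dual ℝ A)} {x : A} (hx : x ∈ S.Face Δ Y) {c : ℝ}
    (hc : 0 < c) : c • x ∈ S.Face Δ Y := by
  refine ⟨fun a ha => by simp [hx.1 a ha], fun l hl h => ?_⟩
  rw [map_smul, smul_eq_mul]
  exact mul_pos hc (hx.2 l hl h)

theorem face_closure {Δ Y : Finset (Module.Dual ℝ A)} {x : A}
    (hx : x ∈ closure (S.Face Δ Y)) : (∀ a ∈ Y, a x = 0) ∧
    ∀ l ∈ S.Λ, ¬ supp Δ (S.lam0 Δ - l) ⊆ Y → 0 ≤ (S.lam0 Δ - l) x := by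
  refine ⟨fun a ha => ?_, fun l hl h => ?_⟩
  · have hc : IsClosed {z : A | a z = 0} :=
      isClosed_eq a.continuous_of_finiteDimensional continuous_const
    exact closure_minimal (fun z hz => hz.1 a ha) hc hx
  · have hc : IsClosed {z : A | 0 ≤ (S.lam0 Δ - l) z} :=
      isClosed_le continuous_const (S.lam0 Δ - l).continuous_of_finiteDimensional
    exact closure_minimal (fun z hz => (hz.2 l hl h).le) hc hx

theorem face_add_closure {Δ Y : Finset (Module.Dual ℝ A)} {x y : A}
    (hx : x ∈ S.Face Δ Y) (hy : y ∈ closure (S.Face Δ Y)) : x + y ∈ S.Face Δ Y := by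
  have hy := S.face_closure hy
  refine ⟨fun a ha => by simp [hx.1 a ha, hy.1 a ha], fun l hl h => ?_⟩
  rw [map_add]
  exact add_pos_of_pos_of_nonneg (hx.2 l hl h) (hy.2 l hl h)

theorem face_add {Δ Y : Finset (Module.Dual ℝ A)} {x y : A}
    (hx : x ∈ S.Face Δ Y) (hy : y ∈ S.Face Δ Y) : x + y ∈ S.Face Δ Y :=
  S.face_add_closure hx (subset_closure hy)

theorem face_zero_closure {Δ Y : Finset (Module.Dual ℝ A)} {x : A}
    (hx : x ∈ S.Face Δ Y) : (0 : A) ∈ closure (S.Face Δ Y) := by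
  have h1 : Tendsto (fun c : ℝ => c • x) (𝓝[>] 0) (𝓝 ((0 : ℝ) • x)) :=
    (continuous_id.smul continuous_const).continuousWithinAt
  rw [zero_smul] at h1
  refine mem_closure_of_tendsto h1 ?_
  filter_upwards [self_mem_nhdsWithin] with c hc
  exact S.face_smul hx hc

theorem face_absorb {Δ Y : Finset (Module.Dual ℝ A)} {x w : A}
    (hx : x ∈ S.Face Δ Y) (hw : w ∈ Submodule.span ℝ (S.Face Δ Y)) :
    ∀ᶠ s : ℝ in atTop, w + s • x ∈ S.Face Δ Y := by
  have h1 : ∀ a ∈ Y, a w = 0 := by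
    intro a ha
    induction hw using Submodule.span_induction with
    | mem z hz => exact hz.1 a ha
    | zero => simp
    | add u v _ _ hu hv => simp [hu, hv]
    | smul c u _ hu => simp [hu]
  have h2 : ∀ l ∈ S.Λ, ∀ᶠ s : ℝ in atTop,
      ¬ supp Δ (S.lam0 Δ - l) ⊆ Y → 0 < (S.lam0 Δ - l) (w + s • x) := by
    intro l hl
    by_cases h : supp Δ (S.lam0 Δ - l) ⊆ Y
    · exact Eventually.of_forall fun _ h' => absurd h h'
    · have hp := hx.2 l hl h
      filter_upwards [eventually_gt_atTop (-(S.lam0 Δ - l) w / (S.lam0 Δ - l) x)] with s hs _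
      rw [div_lt_iff₀ hp] at hs
      rw [map_add, map_smul, smul_eq_mul]
      linarith
  have h3 := (Finset.eventually_all S.Λ).2 h2
  filter_upwards [h3] with s hs
  refine ⟨fun a ha => by simp [h1 a ha, hx.1 a ha], hs⟩

theorem mkAbar_eq {F G : S.Faces} {u v : A} :
    S.mkAbar F u = S.mkAbar G v ↔ F = G ∧ u - v ∈ Submodule.span ℝ F.val := by
  have heq : Equivalence S.AbarRel := by
    refine ⟨fun p => ⟨rfl, by simp⟩, ?_, ?_⟩
    · rintro ⟨p1, p2⟩ ⟨q1, q2⟩ ⟨h1, h2⟩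
      dsimp only at h1 h2
      subst h1
      refine ⟨rfl, ?_⟩
      have := Submodule.neg_mem _ h2
      rwa [neg_sub] at this
    · rintro ⟨p1, p2⟩ ⟨q1, q2⟩ ⟨r1, r2⟩ ⟨h1, h2⟩ ⟨h3, h4⟩
      dsimp only at h1 h2 h3 h4
      subst h1
      subst h3
      refine ⟨rfl, ?_⟩
      have := Submodule.add_mem _ h2 h4
      rwa [sub_add_sub_cancel] at this
  have h1 : S.mkAbar F u = S.mkAbar G v ↔ S.AbarRel (F, u) (G, v) := by
    refine Iff.trans ?_ heq.eqvGen_iff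
    exact Quot.eq
  exact h1

theorem tendsto_mkAbar (F₀ : S.Faces) (hF₀ : F₀.val = ({0} : Set A)) (F : S.Faces)
    (u f : A) (hf : f ∈ F.val) :
    Tendsto (fun s : ℝ => S.mkAbar F₀ (u + s • f)) atTop (𝓝 (S.mkAbar F u)) := by
  rw [TopologicalSpace.tendsto_nhds_generateFrom_iff]
  rintro _ ⟨F1, U, hU, hUb, rfl⟩ ⟨F', hF', v, hv, e⟩
  obtain ⟨rfl, hw⟩ := S.mkAbar_eq.1 e
  obtain ⟨u1, hu1, f1, hf1, rfl⟩ := Set.mem_add.1 hv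
  obtain ⟨Δ, Y, hΔ, hY, hFe⟩ := F.2
  obtain ⟨Δ1, Y1, hΔ1, hY1, hF1e⟩ := F1.2
  rw [hFe] at hw hf
  filter_upwards [S.face_absorb hf hw] with s hs
  refine ⟨F₀, ?_, _, ?_, rfl⟩
  · rw [hF₀, Set.singleton_subset_iff, hF1e]
    rw [hF1e] at hf1
    exact S.face_zero_closure hf1
  · refine Set.mem_add.2 ⟨u1, hu1, f1 + (u - (u1 + f1) + s • f), ?_, by abel⟩
    have h1 : u - (u1 + f1) + s • f ∈ closure F1.val := hF' (by rw [hFe]; exact hs)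
    rw [hF1e] at h1 hf1 ⊢
    exact S.face_add_closure hf1 h1

theorem le_of_mem_closure (F₀ : S.Faces) (hF₀ : F₀.val = ({0} : Set A)) (F : S.Faces)
    (a : Module.Dual ℝ A) (ha : ∀ f ∈ F.val, a f ≤ 0) (u w : A) (t : ℝ)
    (hu : S.mkAbar F u ∈ closure (S.mkAbar F₀ '' {z : A | -t ≤ a z}))
    (hw : w ∈ Submodule.span ℝ F.val) : -t ≤ a (u + w) := by
  obtain ⟨Δ, Y, hΔ, hY, hFe⟩ := F.2
  obtain ⟨f, hf⟩ : F.val.Nonempty := by rw [hFe]; exact S.face_nonempty hΔ hY.1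
  have hcont : Continuous a := a.continuous_of_finiteDimensional
  refine le_of_forall_pos_lt_add fun ε hε => ?_
  let U : Set A := {z | a z < a (u + w) + ε} ∩ Metric.ball (u + w) 1
  have hUo : IsOpen U := (isOpen_lt hcont continuous_const).inter Metric.isOpen_ball
  have hUb : IsBounded U := Metric.isBounded_ball.subset Set.inter_subset_right
  have huU : u + w ∈ U := ⟨by simpa using hε, Metric.mem_ball_self one_pos⟩
  have hop : IsOpen (S.Gamma F U) :=
    TopologicalSpace.isOpen_generateFrom_of_mem ⟨F, U, hUo, hUb, rfl⟩
  have hmem : S.mkAbar F u ∈ S.Gamma F U := by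
    refine ⟨F, subset_closure, u + w + f, Set.add_mem_add huU hf, ?_⟩
    rw [S.mkAbar_eq]
    refine ⟨rfl, ?_⟩
    have : u - (u + w + f) = -(w + f) := by abel
    rw [this]
    exact Submodule.neg_mem _ (Submodule.add_mem _ hw (Submodule.subset_span hf))
  obtain ⟨_, ⟨F', hF', v, hv, rfl⟩, z, hz, e⟩ := mem_closure_iff.1 hu _ hop hmem
  obtain ⟨_, hzv⟩ := S.mkAbar_eq.1 e
  rw [hF₀, Submodule.span_zero_singleton, Submodule.mem_bot, sub_eq_zero] at hzv
  subst hzv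
  obtain ⟨u1, hu1, f1, hf1, rfl⟩ := Set.mem_add.1 hv
  have h1 := ha f1 hf1
  have h2 : a u1 < a (u + w) + ε := hu1.1
  have h3 : -t ≤ a (u1 + f1) := hz
  rw [map_add] at h3
  linarith

/-- The element of `A` representing the form `inn · a`. -/
theorem exists_sharp (a : Module.Dual ℝ A) : ∃ v : A, ∀ φ : Module.Dual ℝ A, φ v = S.inn φ a := by
  let ψ : Module.Dual ℝ (Module.Dual ℝ A) :=
    { toFun := fun φ => S.inn φ a
      map_add' := fun x y => S.inn_add_left x y a
      map_smul' := fun c x => S.inn_smul_left c x a }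
  obtain ⟨x, hx⟩ := (Module.evalEquiv ℝ A).surjective ψ
  refine ⟨x, fun φ => ?_⟩
  have : φ x = ψ φ := by rw [← hx]; rfl
  exact this

/-- The reflection of `A` in the root `a`. -/
def sA (a : Module.Dual ℝ A) : A →ₗ[ℝ] A :=
  LinearMap.id - (2 / S.inn a a) • a.smulRight (S.exists_sharp a).choose

theorem sA_apply (a : Module.Dual ℝ A) (x : A) :
    S.sA a x = x - (2 / S.inn a a * a x) • (S.exists_sharp a).choose := by
  simp [sA, smul_smul]

theorem dual_sA (a φ : Module.Dual ℝ A) (x : A) :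
    φ (S.sA a x) = S.toRootWeightData.refl a φ x := by
  rw [sA_apply, map_sub, map_smul, (S.exists_sharp a).choose_spec, RootWeightData.refl,
    LinearMap.sub_apply, LinearMap.smul_apply, smul_eq_mul, smul_eq_mul]
  ring

theorem sA_sA {a : Module.Dual ℝ A} (ha : a ∈ S.Φ) (x : A) : S.sA a (S.sA a x) = x := by
  have hp := S.inn_pos a (S.root_ne_zero a ha)
  have h1 : a (S.sA a x) = - a x := by
    rw [sA_apply, map_sub, map_smul, (S.exists_sharp a).choose_spec, smul_eq_mul]
    field_simp
    ring
  rw [sA_apply, h1, sA_apply]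
  module

theorem sA_face {Δ Y : Finset (Module.Dual ℝ A)} (hΔ : S.toRootWeightData.IsBase Δ)
    (hY : S.toRootWeightData.Admissible Δ Y) {a : Module.Dual ℝ A} (ha : a ∈ S.Φ)
    {x : A} (hx : x ∈ S.Face Δ Y) (hax : a x = 0) {y : A} (hy : y ∈ S.Face Δ Y) :
    S.sA a y ∈ S.Face Δ Y := by
  rw [S.face_iff hΔ hY] at hx hy ⊢
  have hrx : ∀ l : Module.Dual ℝ A, S.toRootWeightData.refl a l x = l x := by
    intro l
    rw [RootWeightData.refl, LinearMap.sub_apply, LinearMap.smul_apply, hax]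
    simp
  have hM : ∀ l ∈ S.Λ, (supp Δ (S.lam0 Δ - l) ⊆ Y ↔ l x = S.lam0 Δ x) := by
    intro l hl
    refine ⟨(hx l hl).1, fun h => ?_⟩
    by_contra hn
    exact absurd h ((hx l hl).2 hn).ne
  have h0 := S.lam0_mem Δ hΔ
  have h0r := S.refl_weight ha h0
  have e0 : S.toRootWeightData.refl a (S.lam0 Δ) y = S.lam0 Δ y :=
    (hy _ h0r).1 ((hM _ h0r).2 (hrx _))
  intro l hl
  have hlr := S.refl_weight ha hl
  rw [dual_sA, dual_sA, e0]
  refine ⟨fun h => ?_, fun h => ?_⟩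
  · exact (hy _ hlr).1 ((hM _ hlr).2 ((hrx l).trans ((hM l hl).1 h)))
  · refine (hy _ hlr).2 fun h' => h ?_
    exact (hM l hl).2 ((hrx l).symm.trans ((hM _ hlr).1 h'))

theorem exists_zero {Δ Y : Finset (Module.Dual ℝ A)} (a : Module.Dual ℝ A) {x y : A}
    (hx : x ∈ S.Face Δ Y) (hy : y ∈ S.Face Δ Y) (hax : 0 < a x) (hay : a y < 0) :
    ∃ z ∈ S.Face Δ Y, a z = 0 := by
  refine ⟨(-a y) • x + a x • y, S.face_add (S.face_smul hx (by linarith)) (S.face_smul hy hax), ?_⟩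
  simp
  ring

theorem exists_fixed {Δ Y : Finset (Module.Dual ℝ A)} (T : A →ₗ[ℝ] A)
    (hT : ∀ x ∈ S.Face Δ Y, T x ∈ S.Face Δ Y)
    (hΦ : ∀ φ ∈ S.Φ, φ.comp T ∈ S.Φ) {x : A} (hx : x ∈ S.Face Δ Y) :
    ∃ y ∈ S.Face Δ Y, T y = y := by
  have hk : ∀ k : ℕ, ∀ φ ∈ S.Φ, φ.comp (T ^ k) ∈ S.Φ := by
    intro k
    induction k with
    | zero => intro φ h; exact h
    | succ k ih =>
      intro φ h
      have := hΦ _ (ih φ h)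
      rwa [LinearMap.comp_assoc, ← Module.End.mul_eq_comp (T ^ k) T, ← pow_succ] at this
  let g : ℕ → (S.Φ → S.Φ) := fun k φ => ⟨φ.1.comp (T ^ k), hk k φ.1 φ.2⟩
  obtain ⟨i, j, hij, hg⟩ := Finite.exists_ne_map_eq_of_infinite g
  wlog hlt : i < j generalizing i j
  · exact this j i hij.symm hg.symm (by omega)
  have hpow : (T ^ i) x = (T ^ j) x := by
    have h1 : ∀ φ : Module.Dual ℝ A, φ ((T ^ i) x) = φ ((T ^ j) x) := by
      intro φ
      have hm : φ ∈ Submodule.span ℝ (S.Φ : Set (Module.Dual ℝ A)) := by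
        rw [S.phi_spans]; trivial
      induction hm using Submodule.span_induction with
      | mem ψ hψ =>
        have := congrArg Subtype.val (congrFun hg ⟨ψ, hψ⟩)
        exact LinearMap.congr_fun this x
      | zero => rfl
      | add p q _ _ hp hq => simp [hp, hq]
      | smul c p _ hp => simp [hp]
    rw [← sub_eq_zero, ← Module.forall_dual_apply_eq_zero_iff ℝ]
    intro φ
    rw [map_sub, h1, sub_self]
  have hmem : ∀ k : ℕ, (T ^ k) x ∈ S.Face Δ Y := by
    intro k
    induction k with
    | zero => simpa using hx
    | succ k ih => rw [pow_succ', Module.End.mul_apply]; exact hT _ ih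
  refine ⟨∑ k ∈ Finset.Ico i j, (T ^ k) x, ?_, ?_⟩
  · refine Finset.sum_induction_nonempty _ (fun z => z ∈ S.Face Δ Y)
      (fun _ _ h1 h2 => S.face_add h1 h2) (Finset.nonempty_Ico.2 hlt) (fun k _ => hmem k)
  · rw [map_sum]
    have h1 : ∀ k, T ((T ^ k) x) = (T ^ (k + 1)) x := by
      intro k; rw [pow_succ', Module.End.mul_apply]
    simp only [h1]
    have h2 := Finset.sum_Ico_sub (fun k => (T ^ k) x) hlt.le
    rw [Finset.sum_sub_distrib, ← hpow, sub_self, sub_eq_zero] at h2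
    exact h2

theorem key_pos {Δ Y : Finset (Module.Dual ℝ A)} (hΔ : S.toRootWeightData.IsBase Δ)
    (hY : S.toRootWeightData.Admissible Δ Y) {a b : Module.Dual ℝ A} (ha : a ∈ S.Φ)
    (hb : b ∈ S.Φ) (hprop : ∀ c : ℝ, b ≠ c • a) {m n : ℝ} (hm : 0 < m) (hn : 0 < n)
    {x y : A} (hx : x ∈ S.Face Δ Y) (hy : y ∈ S.Face Δ Y) (hax : 0 < a x) (hby : 0 < b y) :
    ∃ z ∈ S.Face Δ Y, 0 < (m • a + n • b) z := by
  by_contra! hcon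
  have hcv : ∀ z, (m • a + n • b) z = m * a z + n * b z := fun z => by simp
  have hbx : b x < 0 := by
    have := hcon x hx
    rw [hcv] at this
    have h1 := mul_pos hm hax
    by_contra! h
    have := mul_nonneg hn.le h
    linarith
  have hay : a y < 0 := by
    have := hcon y hy
    rw [hcv] at this
    have h1 := mul_pos hn hby
    by_contra! h
    have := mul_nonneg hm.le h
    linarith
  obtain ⟨za, hza, hza0⟩ := S.exists_zero a hx hy hax hay
  obtain ⟨zb, hzb, hzb0⟩ := S.exists_zero b hy hx hby hbx
  have sa : ∀ z ∈ S.Face Δ Y, S.sA a z ∈ S.Face Δ Y := fun z hz => S.sA_face hΔ hY ha hza hza0 hz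
  have sb : ∀ z ∈ S.Face Δ Y, S.sA b z ∈ S.Face Δ Y := fun z hz => S.sA_face hΔ hY hb hzb hzb0 hz
  have haa := S.inn_pos a (S.root_ne_zero a ha)
  have hbb := S.inn_pos b (S.root_ne_zero b hb)
  have hreflΦ : ∀ c ∈ S.Φ, ∀ φ ∈ S.Φ, φ.comp (S.sA c) ∈ S.Φ := by
    intro c hc φ hφ
    have : φ.comp (S.sA c) = S.toRootWeightData.refl c φ := by
      ext z
      exact S.dual_sA c φ z
    rw [this]
    exact S.refl_mem c hc φ hφ
  obtain ⟨w, hw, hTw⟩ := S.exists_fixed ((S.sA a).comp (S.sA b))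
    (fun z hz => sa _ (sb z hz))
    (fun φ hφ => by
      rw [← LinearMap.comp_assoc]
      exact hreflΦ b hb _ (hreflΦ a ha φ hφ)) hx
  have hsab : S.sA b w = S.sA a w := by
    have h1 : S.sA a (S.sA b w) = w := hTw
    rw [← S.sA_sA ha (S.sA b w), h1]
  set av := (S.exists_sharp a).choose with hav
  set bv := (S.exists_sharp b).choose with hbv
  have hav' : ∀ φ : Module.Dual ℝ A, φ av = S.inn φ a := (S.exists_sharp a).choose_spec
  have hbv' : ∀ φ : Module.Dual ℝ A, φ bv = S.inn φ b := (S.exists_sharp b).choose_spec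
  rw [sA_apply, sA_apply, ← hav, ← hbv] at hsab
  set α := 2 / S.inn a a * a w with hα
  set β := 2 / S.inn b b * b w with hβ
  have hαβ : α • av = β • bv := (sub_right_injective hsab).symm
  have inn_lin : ∀ (φ : Module.Dual ℝ A) (p q : ℝ),
      S.inn φ (p • a + q • b) = p * S.inn φ a + q * S.inn φ b := by
    intro φ p q
    rw [S.inn_symm, S.inn_add_left, S.inn_smul_left, S.inn_smul_left, S.inn_symm a, S.inn_symm b]
  have hvec : α • a + (-β) • b = 0 := by
    by_contra hne
    have h1 := S.inn_pos _ hne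
    rw [inn_lin, ← hav', ← hbv'] at h1
    have h2 := congrArg (α • a + (-β) • b) hαβ
    rw [map_smul, map_smul, smul_eq_mul, smul_eq_mul] at h2
    linarith
  have hβ0 : β = 0 := by
    by_contra h
    apply hprop (α / β)
    have h1 : β • b = α • a := by
      have h2 : β • b = α • a - (α • a + (-β) • b) := by module
      rw [h2, hvec, sub_zero]
    rw [div_eq_inv_mul, mul_smul, ← h1, smul_smul, inv_mul_cancel₀ h, one_smul]
  have hα0 : α = 0 := by
    rw [hβ0, neg_zero, zero_smul, add_zero, smul_eq_zero] at hvec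
    exact hvec.resolve_right (S.root_ne_zero a ha)
  have haw : a w = 0 := by
    have : 2 / S.inn a a ≠ 0 := by positivity
    exact (mul_eq_zero.1 hα0).resolve_left this
  have hbw : b w = 0 := by
    have : 2 / S.inn b b ≠ 0 := by positivity
    exact (mul_eq_zero.1 hβ0).resolve_left this
  have hspan : ∀ c : Module.Dual ℝ A, 0 < S.inn c c → (∀ z ∈ S.Face Δ Y, S.sA c z ∈ S.Face Δ Y) →
      ∀ z ∈ S.Face Δ Y, 0 < c z →
      (S.exists_sharp c).choose ∈ Submodule.span ℝ (S.Face Δ Y) := by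
    intro c hc hs z hz hcz
    have h1 := Submodule.sub_mem _ (Submodule.subset_span (R := ℝ) hz)
      (Submodule.subset_span (R := ℝ) (hs z hz))
    rw [sA_apply, sub_sub_cancel] at h1
    exact (Submodule.smul_mem_iff _ (by positivity)).1 h1
  have hcs : m • av + n • bv ∈ Submodule.span ℝ (S.Face Δ Y) :=
    Submodule.add_mem _ (Submodule.smul_mem _ _ (hspan a haa sa x hx hax))
      (Submodule.smul_mem _ _ (hspan b hbb sb y hy hby))
  obtain ⟨s, hs⟩ := (S.face_absorb hw hcs).exists
  have h1 := hcon _ hs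
  have h2 : (m • a + n • b) w = 0 := by rw [hcv, haw, hbw]; ring
  have hne : m • a + n • b ≠ 0 := by
    intro h
    apply hprop (-(m / n))
    have h3 : n • b = -(m • a) := by
      rw [add_comm] at h
      exact eq_neg_of_add_eq_zero_left h
    have h4 : b = n⁻¹ • (n • b) := by rw [smul_smul, inv_mul_cancel₀ hn.ne', one_smul]
    rw [h4, h3, div_eq_inv_mul]
    module
  have h3 := S.inn_pos _ hne
  rw [inn_lin, ← hav', ← hbv'] at h3
  rw [map_add, map_smul, h2, smul_zero, add_zero, map_add, map_smul, map_smul, smul_eq_mul,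
    smul_eq_mul] at h1
  linarith

theorem fOmega_bot (F₀ : S.Faces) (hF₀ : F₀.val = ({0} : Set A)) (F : S.Faces)
    (Ω : Set S.Abar) (hΩ : ∀ p ∈ Ω, ∃ u : A, p = S.mkAbar F u) (a : Module.Dual ℝ A)
    (f : A) (hf : f ∈ F.val) (haf : 0 < a f) : S.fOmega F₀ Ω a = ⊥ := by
  have hmem : ∀ t : ℝ, Ω ⊆ closure (S.mkAbar F₀ '' {z : A | -t ≤ a z}) := by
    intro t p hp
    obtain ⟨u, rfl⟩ := hΩ p hp
    refine mem_closure_of_tendsto (S.tendsto_mkAbar F₀ hF₀ F u f hf) ?_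
    filter_upwards [eventually_ge_atTop ((-t - a u) / a f)] with s hs
    refine ⟨_, ?_, rfl⟩
    rw [div_le_iff₀ haf] at hs
    simp only [Set.mem_ofPred_eq, map_add, map_smul, smul_eq_mul]
    linarith
  rw [EReal.eq_bot_iff_forall_lt]
  intro y
  refine lt_of_le_of_lt (sInf_le ⟨y - 1, hmem _, rfl⟩) ?_
  exact EReal.coe_lt_coe_iff.2 (by linarith)

theorem subset_iff (F₀ : S.Faces) (hF₀ : F₀.val = ({0} : Set A)) (F : S.Faces)
    (Ω : Set S.Abar) (hΩ : ∀ p ∈ Ω, ∃ u : A, p = S.mkAbar F u) (a : Module.Dual ℝ A)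
    (ha : ∀ f ∈ F.val, a f = 0) (t : ℝ) :
    Ω ⊆ closure (S.mkAbar F₀ '' {z : A | -t ≤ a z}) ↔
      ∀ u : A, S.mkAbar F u ∈ Ω → -t ≤ a u := by
  constructor
  · intro h u hu
    have := S.le_of_mem_closure F₀ hF₀ F a (fun f hf => (ha f hf).le) u 0 t (h hu)
      (Submodule.zero_mem _)
    simpa using this
  · intro h p hp
    obtain ⟨u, rfl⟩ := hΩ p hp
    obtain ⟨Δ, Y, hΔ, hY, hFe⟩ := F.2
    obtain ⟨f, hf⟩ : F.val.Nonempty := by rw [hFe]; exact S.face_nonempty hΔ hY.1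
    refine mem_closure_of_tendsto (S.tendsto_mkAbar F₀ hF₀ F u f hf) ?_
    refine Eventually.of_forall fun s => ⟨_, ?_, rfl⟩
    simp only [Set.mem_ofPred_eq, map_add, map_smul, ha f hf, smul_zero, add_zero]
    exact h u hp

theorem pos_or_zero (F₀ : S.Faces) (hF₀ : F₀.val = ({0} : Set A)) (F : S.Faces)
    (Ω : Set S.Abar) (hΩne : Ω.Nonempty)
    (hΩ : ∀ p ∈ Ω, ∃ u : A, p = S.mkAbar F u) (a : Module.Dual ℝ A)
    (ha : S.fOmega F₀ Ω a ≠ ⊤) : (∃ f ∈ F.val, 0 < a f) ∨ ∀ f ∈ F.val, a f = 0 := by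
  by_contra! h
  obtain ⟨hle, f, hf, hne⟩ := h
  have hneg : a f < 0 := lt_of_le_of_ne (hle f hf) hne
  obtain ⟨p, hp⟩ := hΩne
  obtain ⟨u, rfl⟩ := hΩ p hp
  apply ha
  rw [fOmega, sInf_eq_top]
  rintro _ ⟨t, ht, rfl⟩
  exfalso
  have h1 := S.le_of_mem_closure F₀ hF₀ F a hle u (((-t - a u - 1) / a f) • f) t (ht hp)
    (Submodule.smul_mem _ _ (Submodule.subset_span hf))
  rw [map_add, map_smul, smul_eq_mul, div_mul_cancel₀ _ hne] at h1
  linarith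

theorem pos_of_bot (F₀ : S.Faces) (hF₀ : F₀.val = ({0} : Set A)) (F : S.Faces)
    (Ω : Set S.Abar) (hΩne : Ω.Nonempty)
    (hΩ : ∀ p ∈ Ω, ∃ u : A, p = S.mkAbar F u) (a : Module.Dual ℝ A)
    (ha : S.fOmega F₀ Ω a = ⊥) : ∃ f ∈ F.val, 0 < a f := by
  rcases S.pos_or_zero F₀ hF₀ F Ω hΩne hΩ a (by rw [ha]; exact bot_ne_top) with h | h
  · exact h
  · exfalso
    obtain ⟨p, hp⟩ := hΩne
    obtain ⟨u, rfl⟩ := hΩ p hp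
    have h1 : ((-a u : ℝ) : EReal) ≤ S.fOmega F₀ Ω a := by
      refine le_sInf ?_
      rintro _ ⟨t, ht, rfl⟩
      have := (S.subset_iff F₀ hF₀ F Ω hΩ a h t).1 ht u hp
      exact EReal.coe_le_coe_iff.2 (by linarith)
    rw [ha] at h1
    exact EReal.coe_ne_bot _ (le_bot_iff.1 h1)

theorem zero_of_real (F₀ : S.Faces) (hF₀ : F₀.val = ({0} : Set A)) (F : S.Faces)
    (Ω : Set S.Abar) (hΩne : Ω.Nonempty)
    (hΩ : ∀ p ∈ Ω, ∃ u : A, p = S.mkAbar F u) (a : Module.Dual ℝ A) (r : ℝ)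
    (ha : S.fOmega F₀ Ω a = (r : EReal)) :
    (∀ f ∈ F.val, a f = 0) ∧ ∀ ε : ℝ, 0 < ε →
      ∃ t < r + ε, Ω ⊆ closure (S.mkAbar F₀ '' {z : A | -t ≤ a z}) := by
  constructor
  · refine (S.pos_or_zero F₀ hF₀ F Ω hΩne hΩ a (by rw [ha]; exact EReal.coe_ne_top r)).resolve_left ?_
    rintro ⟨f, hf, haf⟩
    rw [S.fOmega_bot F₀ hF₀ F Ω hΩ a f hf haf] at ha
    exact EReal.coe_ne_bot r ha.symm
  · intro ε hε
    have h1 : S.fOmega F₀ Ω a < ((r + ε : ℝ) : EReal) := by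
      rw [ha]; exact EReal.coe_lt_coe_iff.2 (by linarith)
    obtain ⟨_, ⟨t, ht, rfl⟩, hlt⟩ := sInf_lt_iff.1 h1
    exact ⟨t, EReal.coe_lt_coe_iff.1 hlt, ht⟩

end Helpers

end RootWeightSystem

/-- Let `Ω` be a non-empty subset of a single stratum `A_F`,
`F = F_Y^Δ`, and let `a`, `b` be non-proportional non-divisible roots with
`ma + nb ∈ Φ` (`m, n ≥ 1`).  Then: (i) if `f_Ω(a) = -∞` and `f_Ω(b) ≠ +∞` (or
symmetrically), then `f_Ω(ma + nb) = -∞`; (ii) if `f_Ω(a)` and `f_Ω(b)` are real,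
then `f_Ω(ma + nb) ≤ m·f_Ω(a) + n·f_Ω(b)`. -/
theorem fOmega_linear_combination (S : RootWeightSystem A)
    (F₀ : S.Faces) (hF₀ : F₀.val = ({0} : Set A))
    (Δ Y : Finset (Module.Dual ℝ A))
    (hΔ : S.toRootWeightData.IsBase Δ) (hY : S.toRootWeightData.Admissible Δ Y)
    (F : S.Faces) (hF : F.val = S.Face Δ Y)
    (Ω : Set S.Abar) (hΩne : Ω.Nonempty)
    (hΩ : ∀ p ∈ Ω, ∃ u : A, p = S.mkAbar F u)
    (a b : Module.Dual ℝ A)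
    (ha : a ∈ S.Φ) (hared : (2⁻¹ : ℝ) • a ∉ S.Φ)
    (hb : b ∈ S.Φ) (hbred : (2⁻¹ : ℝ) • b ∉ S.Φ)
    (hprop : ∀ c : ℝ, b ≠ c • a)
    (m n : ℕ) (hm : 1 ≤ m) (hn : 1 ≤ n)
    (hroot : (m : ℝ) • a + (n : ℝ) • b ∈ S.Φ) :
    ((S.fOmega F₀ Ω a = ⊥ → S.fOmega F₀ Ω b ≠ ⊤ →
        S.fOmega F₀ Ω ((m : ℝ) • a + (n : ℝ) • b) = ⊥) ∧
      (S.fOmega F₀ Ω b = ⊥ → S.fOmega F₀ Ω a ≠ ⊤ →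
        S.fOmega F₀ Ω ((m : ℝ) • a + (n : ℝ) • b) = ⊥)) ∧
    ∀ r s : ℝ, S.fOmega F₀ Ω a = (r : EReal) → S.fOmega F₀ Ω b = (s : EReal) →
      S.fOmega F₀ Ω ((m : ℝ) • a + (n : ℝ) • b) ≤
        (((m : ℝ) * r + (n : ℝ) * s : ℝ) : EReal) := by
  have hm' : (0 : ℝ) < m := by exact_mod_cast hm
  have hn' : (0 : ℝ) < n := by exact_mod_cast hn
  have hcv : ∀ z, ((m : ℝ) • a + (n : ℝ) • b) z = m * a z + n * b z := fun z => by simp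
  have both : ∀ f ∈ F.val, ∀ g ∈ F.val, 0 < a f → 0 < b g →
      S.fOmega F₀ Ω ((m : ℝ) • a + (n : ℝ) • b) = ⊥ := by
    intro f hf g hg haf hbg
    rw [hF] at hf hg
    obtain ⟨z, hz, hpos⟩ := S.key_pos hΔ hY ha hb hprop hm' hn' hf hg haf hbg
    rw [← hF] at hz
    exact S.fOmega_bot F₀ hF₀ F Ω hΩ _ z hz hpos
  refine ⟨⟨fun h1 h2 => ?_, fun h1 h2 => ?_⟩, fun r s hr hs => ?_⟩
  · obtain ⟨f, hf, haf⟩ := S.pos_of_bot F₀ hF₀ F Ω hΩne hΩ a h1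
    rcases S.pos_or_zero F₀ hF₀ F Ω hΩne hΩ b h2 with ⟨g, hg, hbg⟩ | h0
    · exact both f hf g hg haf hbg
    · refine S.fOmega_bot F₀ hF₀ F Ω hΩ _ f hf ?_
      rw [hcv, h0 f hf, mul_zero, add_zero]
      exact mul_pos hm' haf
  · obtain ⟨f, hf, hbf⟩ := S.pos_of_bot F₀ hF₀ F Ω hΩne hΩ b h1
    rcases S.pos_or_zero F₀ hF₀ F Ω hΩne hΩ a h2 with ⟨g, hg, hag⟩ | h0
    · exact both g hg f hf hag hbf
    · refine S.fOmega_bot F₀ hF₀ F Ω hΩ _ f hf ?_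
      rw [hcv, h0 f hf, mul_zero, zero_add]
      exact mul_pos hn' hbf
  · obtain ⟨ha0, hat⟩ := S.zero_of_real F₀ hF₀ F Ω hΩne hΩ a r hr
    obtain ⟨hb0, hbt⟩ := S.zero_of_real F₀ hF₀ F Ω hΩne hΩ b s hs
    have hc0 : ∀ f ∈ F.val, ((m : ℝ) • a + (n : ℝ) • b) f = 0 := by
      intro f hf
      rw [hcv, ha0 f hf, hb0 f hf]
      ring
    refine EReal.le_of_forall_lt_iff_le.1 fun z hz => ?_
    have hz' : (m : ℝ) * r + n * s < z := EReal.coe_lt_coe_iff.1 hz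
    have hmn : (0 : ℝ) < m + n := by linarith
    obtain ⟨t, ht, hta⟩ := hat ((z - (m * r + n * s)) / (m + n)) (div_pos (by linarith) hmn)
    obtain ⟨t', ht', htb⟩ := hbt ((z - (m * r + n * s)) / (m + n)) (div_pos (by linarith) hmn)
    refine sInf_le ⟨z, ?_, rfl⟩
    rw [Set.mem_ofPred_eq, S.subset_iff F₀ hF₀ F Ω hΩ _ hc0]
    intro u hu
    have h1 := (S.subset_iff F₀ hF₀ F Ω hΩ a ha0 t).1 hta u hu
    have h2 := (S.subset_iff F₀ hF₀ F Ω hΩ b hb0 t').1 htb u hu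
    rw [hcv]
    have h3 : -(m * (r + (z - (m * r + n * s)) / (m + n))) ≤ m * a u := by
      rw [← mul_neg]
      exact mul_le_mul_of_nonneg_left (by linarith) hm'.le
    have h4 : -(n * (s + (z - (m * r + n * s)) / (m + n))) ≤ n * b u := by
      rw [← mul_neg]
      exact mul_le_mul_of_nonneg_left (by linarith) hn'.le
    have h5 : m * (r + (z - (m * r + n * s)) / (m + n))
        + n * (s + (z - (m * r + n * s)) / (m + n)) = z := by
      field_simp
      ring
    linarith
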